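/- arXiv:2410.13800 — 8 statements merged into one kernel-verified Lean document; each statement's English description precedes it below -/
import Mathlib

section
/- Let P be a reversible Markov chain on a finite state space S with stationary distribution μ, and let A ⊆ S be a nonempty set with μ(A) > 0. Define the restricted distribution μ_A by μ_A(σ) = μ(σ)/μ(A) for σ ∈ A and μ_A(σ) = 0 for σ ∉ A. Then the detailed-balance violation of μ_A equals the conductance of A: (1/2) Σ_{σ,σ'∈S} |P(σ'|σ)μ_A(σ) − P(σ|σ')μ_A(σ')| = Γ(A). In particular, μ_A is Γ(A)-strongly metastable with respect to P. -/
open Finset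

/-- For a reversible Markov chain `P` with stationary distribution `μ` and a
nonempty set `A` of positive measure, the detailed-balance violation of the restricted
distribution `μ_A` equals the conductance `Γ(A)`; in particular `μ_A` is `Γ(A)`-strongly
metastable. -/
theorem restricted_distribution_strongly_metastable {S : Type*} [Fintype S] [DecidableEq S]
    (P : S → S → ℝ) (hP0 : ∀ i j, 0 ≤ P i j) (hP1 : ∀ j, ∑ i, P i j = 1)
    (μ : S → ℝ) (hμ0 : ∀ i, 0 ≤ μ i) (hμ1 : ∑ i, μ i = 1)
    (hrev : ∀ i j, P i j * μ j = P j i * μ i)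
    (A : Finset S) (hA : A.Nonempty) (hμA : 0 < ∑ j ∈ A, μ j)
    (μA : S → ℝ)
    (hμAdef : ∀ σ, μA σ = if σ ∈ A then μ σ / (∑ j ∈ A, μ j) else 0)
    (Γ : ℝ)
    (hΓ : Γ = (∑ j ∈ A, ∑ i ∈ Aᶜ, P i j * μ j) / (∑ j ∈ A, μ j)) :
    (1 / 2) * ∑ σ, ∑ σ', |P σ' σ * μA σ - P σ σ' * μA σ'| = Γ ∧
    (1 / 2) * ∑ σ, ∑ σ', |P σ' σ * μA σ - P σ σ' * μA σ'| ≤ Γ := by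
  have key : (1 / 2) * ∑ σ, ∑ σ', |P σ' σ * μA σ - P σ σ' * μA σ'| = Γ := by
    set m := ∑ j ∈ A, μ j with hm
    let f : S → S → ℝ := fun j i => if j ∈ A then (if i ∈ Aᶜ then P i j * μ j / m else 0) else 0
    have hterm : ∀ σ σ', |P σ' σ * μA σ - P σ σ' * μA σ'| = f σ σ' + f σ' σ := by
      intro σ σ'
      have h1 : 0 ≤ P σ' σ * μ σ / m := div_nonneg (mul_nonneg (hP0 _ _) (hμ0 _)) hμA.le
      have h2 : 0 ≤ P σ σ' * μ σ' / m := div_nonneg (mul_nonneg (hP0 _ _) (hμ0 _)) hμA.le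
      rw [hμAdef σ, hμAdef σ']
      by_cases h : σ ∈ A <;> by_cases h' : σ' ∈ A
      · simp [f, h, h', ← mul_div_assoc, hrev σ σ']
      · simp [f, h, h', ← mul_div_assoc, abs_of_nonneg h1]
      · simp [f, h, h', ← mul_div_assoc, abs_of_nonneg h2]
      · simp [f, h, h']
    have hsum : ∑ σ, ∑ σ', f σ σ' = Γ := by
      rw [hΓ, Finset.sum_div]
      simp only [f, Finset.sum_div]
      rw [← Finset.sum_filter_add_sum_filter_not Finset.univ (· ∈ A)]
      rw [Finset.sum_eq_zero (s := Finset.univ.filter (¬ · ∈ A))]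
      · rw [add_zero, Finset.filter_univ_mem]
        refine Finset.sum_congr rfl fun j hj => ?_
        simp only [hj, if_true]
        rw [← Finset.sum_filter, Finset.filter_univ_mem]
      · intro j hj
        simp [(Finset.mem_filter.mp hj).2]
    have hswap : ∑ σ, ∑ σ', f σ' σ = Γ := by
      rw [Finset.sum_comm, hsum]
    simp only [hterm, Finset.sum_add_distrib]
    rw [hsum, hswap]
    ring
  exact ⟨key, key.le⟩
end

section
/- Consider n discrete random variables each taking values in a finite set Q, so the state space is S = Q^n. Let P be a reversible Markov chain on S with strictly positive stationary distribution μ satisfying the bounded spin-flip condition with constant ω_P > 0, and let ν be a strictly positive η-strongly metastable distribution of P. Then the single-variable conditionals of ν are on average close to those of μ: Σ_{u=1}^n Σ_{σ∈Q^n} ν(σ) |ν(·|σ_{∖u}) − μ(·|σ_{∖u})|_TV ≤ η/ω_P. -/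
open Finset

/-- Single-variable conditional of a strictly positive distribution `ν` on `Q^n`:
`ν(q | σ_{∖u}) = ν(σ_{u→q}) / Σ_p ν(σ_{u→p})`. -/
noncomputable def singleCond {n : ℕ} {Q : Type*} [Fintype Q] [DecidableEq Q]
    (ν : (Fin n → Q) → ℝ) (σ : Fin n → Q) (u : Fin n) (q : Q) : ℝ :=
  ν (Function.update σ u q) / ∑ p, ν (Function.update σ u p)

theorem cc_swap {n : ℕ} {Q : Type*} [Fintype Q] [DecidableEq Q] (u : Fin n)
    (F : (Fin n → Q) → Q → ℝ) :
    ∑ σ, ∑ q, F σ q = ∑ σ, ∑ q, F (Function.update σ u q) (σ u) := by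
  have hinv : Function.Involutive
      (fun x : (Fin n → Q) × Q => (Function.update x.1 u x.2, x.1 u)) := by
    intro x
    simp
  rw [← Fintype.sum_prod_type', ← Fintype.sum_prod_type']
  exact (Equiv.sum_comp hinv.toPerm (fun x : (Fin n → Q) × Q => F x.1 x.2)).symm

theorem cc_cond_update {n : ℕ} {Q : Type*} [Fintype Q] [DecidableEq Q]
    (ν : (Fin n → Q) → ℝ) (σ : Fin n → Q) (u : Fin n) (p q : Q) :
    singleCond ν (Function.update σ u p) u q = singleCond ν σ u q := by
  simp [singleCond]

theorem cc_count {n : ℕ} {Q : Type*} [Fintype Q] [DecidableEq Q]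
    (σ : Fin n → Q) (F : (Fin n → Q) → ℝ) (h0 : ∀ τ, 0 ≤ F τ) (hσ : F σ = 0) :
    ∑ u, ∑ q, F (Function.update σ u q) ≤ ∑ τ, F τ := by
  rw [← Fintype.sum_prod_type' (f := fun u q => F (Function.update σ u q))]
  have h1 : ∑ x : Fin n × Q, F (Function.update σ x.1 x.2)
      = ∑ x ∈ univ.filter (fun x : Fin n × Q => x.2 ≠ σ x.1),
        F (Function.update σ x.1 x.2) := by
    symm
    apply Finset.sum_filter_of_ne
    intro x _ hx he
    apply hx
    rw [he, Function.update_eq_self, hσ]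
  have hinj : Set.InjOn (fun x : Fin n × Q => Function.update σ x.1 x.2)
      (univ.filter (fun x : Fin n × Q => x.2 ≠ σ x.1) : Finset (Fin n × Q)) := by
    rintro ⟨u, q⟩ hx ⟨v, p⟩ hy hxy
    simp only [coe_filter, mem_univ, true_and, Set.mem_setOf_eq] at hx hy hxy
    have h2 := congrFun hxy u
    by_cases huv : u = v
    · subst huv
      simp at h2
      rw [h2]
    · simp [huv] at h2
      exact absurd h2 hx
  rw [h1, ← Finset.sum_image (f := F) hinj]
  exact Finset.sum_le_sum_of_subset_of_nonneg (Finset.subset_univ _) (fun τ _ _ => h0 τ)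

/-- **Closeness of conditionals.** If `ν` is an `η`-strongly metastable
distribution of a reversible Markov chain `P` with strictly positive stationary distribution `μ`
satisfying the bounded spin-flip condition with constant `ω_P > 0`, then
`Σ_u Σ_σ ν(σ) |ν(·|σ_{∖u}) − μ(·|σ_{∖u})|_TV ≤ η/ω_P`. -/
theorem closeness_of_conditionals {n : ℕ} {Q : Type*} [Fintype Q] [DecidableEq Q] [Nonempty Q]
    (P : (Fin n → Q) → (Fin n → Q) → ℝ)
    (hP0 : ∀ σ σ', 0 ≤ P σ' σ) (hP1 : ∀ σ, ∑ σ', P σ' σ = 1)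
    (μ : (Fin n → Q) → ℝ) (hμpos : ∀ σ, 0 < μ σ) (hμ1 : ∑ σ, μ σ = 1)
    (hrev : ∀ σ σ', P σ' σ * μ σ = P σ σ' * μ σ')
    (ωP : ℝ) (hωP : 0 < ωP)
    (hflip : ∀ (σ : Fin n → Q) (u : Fin n) (q : Q),
      P (Function.update σ u q) σ / singleCond μ σ u q ≥ ωP)
    (ν : (Fin n → Q) → ℝ) (hνpos : ∀ σ, 0 < ν σ) (hν1 : ∑ σ, ν σ = 1)
    (η : ℝ)
    (hmeta : (1 / 2) * ∑ σ, ∑ σ', |P σ' σ * ν σ - P σ σ' * ν σ'| ≤ η) :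
    ∑ u : Fin n, ∑ σ : Fin n → Q, ν σ *
        ((1 / 2) * ∑ q : Q, |singleCond ν σ u q - singleCond μ σ u q|) ≤ η / ωP := by
  have hM : ∀ σ u, 0 < ∑ p, μ (Function.update σ u p) := fun σ u =>
    Finset.sum_pos (fun p _ => hμpos _) univ_nonempty
  have hN : ∀ σ u, 0 < ∑ p, ν (Function.update σ u p) := fun σ u =>
    Finset.sum_pos (fun p _ => hνpos _) univ_nonempty
  have hc : ∀ σ u q, 0 < singleCond μ σ u q := fun σ u q => div_pos (hμpos _) (hM σ u)
  have hc1 : ∀ σ u, ∑ q, singleCond μ σ u q = 1 := by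
    intro σ u
    unfold singleCond
    rw [← Finset.sum_div]
    exact div_self (hM σ u).ne'
  -- termwise bound
  have key : ∀ σ u q, ωP * |ν σ * singleCond μ σ u q
      - singleCond μ σ u (σ u) * ν (Function.update σ u q)|
      ≤ |P (Function.update σ u q) σ * ν σ
        - P σ (Function.update σ u q) * ν (Function.update σ u q)| := by
    intro σ u q
    have hw := hflip σ u q
    have hcq := hc σ u q
    set τ := Function.update σ u q with hτ
    set w := P τ σ / singleCond μ σ u q with hwdef
    have e1 : P τ σ = w * singleCond μ σ u q := by
      rw [hwdef]; field_simp
    have e2 : P σ τ = w * singleCond μ σ u (σ u) := by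
      have hr := hrev σ τ
      have hMm := hM σ u
      have hτp := hμpos τ
      rw [e1] at hr
      have a1 : singleCond μ σ u q = μ τ / ∑ p, μ (Function.update σ u p) := rfl
      have a2 : singleCond μ σ u (σ u) = μ σ / ∑ p, μ (Function.update σ u p) := by
        simp [singleCond]
      rw [a1] at hr
      rw [a2]
      apply mul_right_cancel₀ hτp.ne'
      rw [← hr]
      ring
    rw [e1, e2]
    have : w * singleCond μ σ u q * ν σ - w * singleCond μ σ u (σ u) * ν τ
        = w * (ν σ * singleCond μ σ u q - singleCond μ σ u (σ u) * ν τ) := by ring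
    rw [this, abs_mul, abs_of_pos (lt_of_lt_of_le hωP hw)]
    exact mul_le_mul_of_nonneg_right hw (abs_nonneg _)
  -- per-site bound
  have site : ∀ u, ∑ σ : Fin n → Q, ν σ * ∑ q : Q, |singleCond ν σ u q - singleCond μ σ u q|
      ≤ ∑ σ : Fin n → Q, ∑ q, |ν σ * singleCond μ σ u q
      - singleCond μ σ u (σ u) * ν (Function.update σ u q)| := by
    intro u
    simp_rw [Finset.mul_sum]
    rw [cc_swap u]
    simp_rw [cc_cond_update]
    apply Finset.sum_le_sum
    intro σ _
    rw [← Finset.sum_mul]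
    refine le_trans (le_of_eq ?_) (Finset.abs_sum_le_sum_abs _ _)
    rw [Finset.sum_sub_distrib, ← Finset.mul_sum, ← Finset.mul_sum, hc1]
    have a2 : singleCond ν σ u (σ u) = ν σ / ∑ p, ν (Function.update σ u p) := by
      simp [singleCond]
    have hNn := hN σ u
    rw [a2]
    nth_rewrite 1 [← abs_of_pos hNn]
    rw [← abs_mul]
    congr 1
    field_simp
  rw [le_div_iff₀ hωP]
  refine le_trans ?_ hmeta
  have hL : ∑ u : Fin n, ∑ σ : Fin n → Q, ν σ *
        ((1 / 2) * ∑ q : Q, |singleCond ν σ u q - singleCond μ σ u q|)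
      = (1 / 2) * ∑ u : Fin n, ∑ σ : Fin n → Q, ν σ *
        ∑ q : Q, |singleCond ν σ u q - singleCond μ σ u q| := by
    rw [Finset.mul_sum]
    refine Finset.sum_congr rfl fun u _ => ?_
    rw [Finset.mul_sum]
    refine Finset.sum_congr rfl fun σ _ => ?_
    ring
  rw [hL, mul_assoc]
  apply mul_le_mul_of_nonneg_left _ (by norm_num)
  calc _ ≤ (∑ u, ∑ σ : Fin n → Q, ∑ q, |ν σ * singleCond μ σ u q
      - singleCond μ σ u (σ u) * ν (Function.update σ u q)|) * ωP :=
        mul_le_mul_of_nonneg_right (Finset.sum_le_sum fun u _ => site u) hωP.le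
    _ = ∑ σ : Fin n → Q, ∑ u, ∑ q, ωP * |ν σ * singleCond μ σ u q
      - singleCond μ σ u (σ u) * ν (Function.update σ u q)| := by
        rw [Finset.sum_comm, mul_comm]
        simp_rw [Finset.mul_sum]
    _ ≤ ∑ σ : Fin n → Q, ∑ u, ∑ q, |P (Function.update σ u q) σ * ν σ
        - P σ (Function.update σ u q) * ν (Function.update σ u q)| :=
        Finset.sum_le_sum fun σ _ => Finset.sum_le_sum fun u _ =>
          Finset.sum_le_sum fun q _ => key σ u q
    _ ≤ _ := Finset.sum_le_sum fun σ _ =>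
        cc_count σ (fun τ => |P τ σ * ν σ - P σ τ * ν τ|) (fun τ => abs_nonneg _) (by simp)
end

section
/- Consider n discrete random variables each taking values in a finite set Q, so the state space is S = Q^n. Let P be a reversible Markov chain on S with strictly positive stationary distribution μ satisfying the bounded spin-flip condition with constant ω_P > 0, and let ν be a strictly positive η-strongly metastable distribution of P. Then the average conditional KL divergences are bounded: Σ_{u=1}^n E_{σ∼ν} D_KL( ν(·|σ_{∖u}) ‖ μ(·|σ_{∖u}) ) ≤ 2η / (ω_P · min_{u,σ} μ(σ_u|σ_{∖u})). -/
open Finset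

lemma aux_swap {n : ℕ} {Q : Type*} [Fintype Q] [DecidableEq Q] (u : Fin n)
    (G : (Fin n → Q) → (Fin n → Q) → ℝ) :
    ∑ σ : Fin n → Q, ∑ q : Q, G σ (Function.update σ u q)
      = ∑ σ : Fin n → Q, ∑ q : Q, G (Function.update σ u q) σ := by
  rw [← Fintype.sum_prod_type', ← Fintype.sum_prod_type']
  refine Finset.sum_bij' (fun x _ => (Function.update x.1 u x.2, x.1 u))
    (fun x _ => (Function.update x.1 u x.2, x.1 u)) ?_ ?_ ?_ ?_ ?_ <;> simp

lemma aux_sum {n : ℕ} {Q : Type*} [Fintype Q] [DecidableEq Q] (σ : Fin n → Q)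
    (T : (Fin n → Q) → ℝ) (h0 : ∀ τ, 0 ≤ T τ) (hσ : T σ = 0) :
    ∑ u : Fin n, ∑ q : Q, T (Function.update σ u q) ≤ ∑ τ, T τ := by
  rw [← Fintype.sum_prod_type' (f := fun u q => T (Function.update σ u q))]
  have h1 : ∑ x : Fin n × Q, T (Function.update σ x.1 x.2)
      = ∑ x ∈ Finset.univ.filter (fun x : Fin n × Q => x.2 ≠ σ x.1),
        T (Function.update σ x.1 x.2) := by
    rw [Finset.sum_filter]
    refine Finset.sum_congr rfl fun x _ => ?_
    split_ifs with h
    · rfl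
    · push Not at h
      rw [h, Function.update_eq_self, hσ]
  rw [h1, ← Finset.sum_image (s := Finset.univ.filter (fun x : Fin n × Q => x.2 ≠ σ x.1))
    (g := fun x : Fin n × Q => Function.update σ x.1 x.2) (f := T)]
  · exact Finset.sum_le_sum_of_subset_of_nonneg (Finset.subset_univ _) fun i _ _ => h0 i
  · rintro ⟨u, q⟩ hx ⟨v, p⟩ hy hxy
    simp only [Finset.coe_filter, Finset.mem_univ, true_and, Set.mem_setOf_eq] at hx hy hxy
    have huv : u = v := by
      by_contra hne
      have := congrFun hxy u
      rw [Function.update_self, Function.update_of_ne hne] at this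
      exact hx this
    subst huv
    have := congrFun hxy u
    simp only [Function.update_self] at this
    rw [this]

lemma aux_kl {Q : Type*} [Fintype Q] (a b : Q → ℝ) (β : ℝ) (hβ : 0 < β)
    (ha : ∀ q, 0 < a q) (hb : ∀ q, β ≤ b q) (ha1 : ∑ q, a q = 1) (hb1 : ∑ q, b q = 1) :
    ∑ q, a q * Real.log (a q / b q) ≤ (∑ q, |a q - b q|) / β := by
  have hb0 : ∀ q, 0 < b q := fun q => hβ.trans_le (hb q)
  have ha' : ∀ q, a q ≤ 1 := fun q => ha1 ▸
    Finset.single_le_sum (fun i _ => (ha i).le) (Finset.mem_univ q)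
  have hb' : ∀ q, b q ≤ 1 := fun q => hb1 ▸
    Finset.single_le_sum (fun i _ => (hb0 i).le) (Finset.mem_univ q)
  have key : ∀ q, a q * Real.log (a q / b q) ≤ (a q - b q) + |a q - b q| / β := by
    intro q
    have h1 := Real.log_le_sub_one_of_pos (div_pos (ha q) (hb0 q))
    have h2 : a q * Real.log (a q / b q) ≤ a q * (a q / b q - 1) :=
      mul_le_mul_of_nonneg_left h1 (ha q).le
    have h3 : a q * (a q / b q - 1) = (a q - b q) + (a q - b q) ^ 2 / b q := by
      have := (hb0 q).ne'
      field_simp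
      ring
    have h4 : (a q - b q) ^ 2 ≤ |a q - b q| := by
      rw [← sq_abs]
      have : |a q - b q| ≤ 1 := by
        rw [abs_le]
        constructor <;> linarith [ha' q, hb' q, ha q, hb0 q]
      nlinarith [abs_nonneg (a q - b q)]
    have h5 : (a q - b q) ^ 2 / b q ≤ |a q - b q| / β :=
      div_le_div₀ (abs_nonneg _) h4 hβ (hb q)
    linarith
  calc _ ≤ ∑ q, ((a q - b q) + |a q - b q| / β) := Finset.sum_le_sum fun q _ => key q
    _ = _ := by
      rw [Finset.sum_add_distrib, Finset.sum_sub_distrib, ha1, hb1, Finset.sum_div]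
      ring

section aux
variable {n : ℕ} {Q : Type*} [Fintype Q] [DecidableEq Q] [Nonempty Q]

lemma singleCond_update (ν : (Fin n → Q) → ℝ) (σ : Fin n → Q) (u : Fin n) (p q : Q) :
    singleCond ν (Function.update σ u p) u q = singleCond ν σ u q := by
  simp [singleCond]

lemma norm_pos (ν : (Fin n → Q) → ℝ) (h : ∀ σ, 0 < ν σ) (σ : Fin n → Q) (u : Fin n) :
    0 < ∑ p, ν (Function.update σ u p) :=
  Finset.sum_pos (fun p _ => h _) Finset.univ_nonempty

lemma singleCond_pos (ν : (Fin n → Q) → ℝ) (h : ∀ σ, 0 < ν σ) (σ : Fin n → Q) (u : Fin n)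
    (q : Q) : 0 < singleCond ν σ u q :=
  div_pos (h _) (norm_pos ν h σ u)

lemma singleCond_sum (ν : (Fin n → Q) → ℝ) (h : ∀ σ, 0 < ν σ) (σ : Fin n → Q) (u : Fin n) :
    ∑ q, singleCond ν σ u q = 1 := by
  simp only [singleCond]
  rw [← Finset.sum_div, div_self (norm_pos ν h σ u).ne']

lemma aux_T (P : (Fin n → Q) → (Fin n → Q) → ℝ)
    (μ : (Fin n → Q) → ℝ) (hμpos : ∀ σ, 0 < μ σ)
    (hrev : ∀ σ σ', P σ' σ * μ σ = P σ σ' * μ σ')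
    (ωP : ℝ)
    (hflip : ∀ (σ : Fin n → Q) (u : Fin n) (q : Q),
      P (Function.update σ u q) σ / singleCond μ σ u q ≥ ωP)
    (ν : (Fin n → Q) → ℝ) (σ : Fin n → Q) (u : Fin n) (q : Q) :
    ωP * |ν σ * singleCond μ σ u q - singleCond μ σ u (σ u) * ν (Function.update σ u q)| ≤
      |P (Function.update σ u q) σ * ν σ
        - P σ (Function.update σ u q) * ν (Function.update σ u q)| := by
  have hf := hflip σ u q
  have hbq := singleCond_pos μ hμpos σ u q
  set τ := Function.update σ u q with hτ
  have hr := hrev σ τ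
  have hM := norm_pos μ hμpos σ u
  have e1 : singleCond μ σ u q = μ τ / ∑ p, μ (Function.update σ u p) := rfl
  have e2 : singleCond μ σ u (σ u) = μ σ / ∑ p, μ (Function.update σ u p) := by
    simp [singleCond]
  have hs := hμpos σ
  have ht := hμpos τ
  have e3 : P σ τ = P τ σ * μ σ / μ τ := by
    rw [hr]; field_simp
  have e4 : P τ σ * ν σ - P σ τ * ν τ = (P τ σ / singleCond μ σ u q) *
      (ν σ * singleCond μ σ u q - singleCond μ σ u (σ u) * ν τ) := by
    rw [e3, e1, e2]
    have := hM.ne'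
    field_simp
  rw [e4, abs_mul]
  exact mul_le_mul_of_nonneg_right (le_trans hf (le_abs_self _)) (abs_nonneg _)

lemma aux_tv (μ ν : (Fin n → Q) → ℝ) (hμpos : ∀ σ, 0 < μ σ) (hνpos : ∀ σ, 0 < ν σ)
    (u : Fin n) :
    ∑ σ : Fin n → Q, ν σ * ∑ q, |singleCond ν σ u q - singleCond μ σ u q| ≤
    ∑ σ : Fin n → Q, ∑ q, |ν σ * singleCond μ σ u q
      - singleCond μ σ u (σ u) * ν (Function.update σ u q)| := by
  have h := aux_swap u (fun σ τ => ν τ * |singleCond ν σ u (σ u) - singleCond μ σ u (σ u)|)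
  simp only [singleCond_update, Function.update_self] at h
  simp only [Finset.mul_sum]
  rw [← h]
  refine Finset.sum_le_sum fun σ _ => ?_
  have hN := norm_pos ν hνpos σ u
  rw [← Finset.sum_mul]
  nth_rewrite 1 [← abs_of_pos hN]
  rw [← abs_mul]
  have : (∑ q, ν (Function.update σ u q)) * (singleCond ν σ u (σ u) - singleCond μ σ u (σ u))
      = ∑ q, (ν σ * singleCond μ σ u q
        - singleCond μ σ u (σ u) * ν (Function.update σ u q)) := by
    rw [Finset.sum_sub_distrib, ← Finset.mul_sum, ← Finset.mul_sum, singleCond_sum μ hμpos]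
    have e : singleCond ν σ u (σ u) = ν σ / ∑ p, ν (Function.update σ u p) := by
      simp [singleCond]
    rw [e, mul_sub, mul_div_cancel₀ _ hN.ne']
    ring
  rw [this]
  exact Finset.abs_sum_le_sum_abs _ _

end aux

/-- Under the hypotheses of the closeness-of-conditionals theorem, the
average conditional KL divergences satisfy
`Σ_u E_{σ∼ν} D_KL(ν(·|σ_{∖u}) ‖ μ(·|σ_{∖u})) ≤ 2η/(ω_P · min_{u,σ} μ(σ_u|σ_{∖u}))`. -/
theorem closeness_of_conditionals_KL {n : ℕ} {Q : Type*} [Fintype Q] [DecidableEq Q] [Nonempty Q]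
    (hn : 0 < n)
    (P : (Fin n → Q) → (Fin n → Q) → ℝ)
    (hP0 : ∀ σ σ', 0 ≤ P σ' σ) (hP1 : ∀ σ, ∑ σ', P σ' σ = 1)
    (μ : (Fin n → Q) → ℝ) (hμpos : ∀ σ, 0 < μ σ) (hμ1 : ∑ σ, μ σ = 1)
    (hrev : ∀ σ σ', P σ' σ * μ σ = P σ σ' * μ σ')
    (ωP : ℝ) (hωP : 0 < ωP)
    (hflip : ∀ (σ : Fin n → Q) (u : Fin n) (q : Q),
      P (Function.update σ u q) σ / singleCond μ σ u q ≥ ωP)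
    (ν : (Fin n → Q) → ℝ) (hνpos : ∀ σ, 0 < ν σ) (hν1 : ∑ σ, ν σ = 1)
    (η : ℝ)
    (hmeta : (1 / 2) * ∑ σ, ∑ σ', |P σ' σ * ν σ - P σ σ' * ν σ'| ≤ η) :
    ∑ u : Fin n, ∑ σ : Fin n → Q, ν σ *
        (∑ q : Q, singleCond ν σ u q * Real.log (singleCond ν σ u q / singleCond μ σ u q))
      ≤ 2 * η / (ωP * ⨅ p : (Fin n) × (Fin n → Q), singleCond μ p.2 p.1 (p.2 p.1)) := by
  haveI : Nonempty (Fin n) := ⟨⟨0, hn⟩⟩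
  set β := ⨅ p : (Fin n) × (Fin n → Q), singleCond μ p.2 p.1 (p.2 p.1) with hβdef
  have hβ : 0 < β := by
    obtain ⟨p, hp⟩ := exists_eq_ciInf_of_finite
      (f := fun p : (Fin n) × (Fin n → Q) => singleCond μ p.2 p.1 (p.2 p.1))
    rw [hβdef, ← hp]
    exact singleCond_pos μ hμpos _ _ _
  have hβle : ∀ σ u q, β ≤ singleCond μ σ u q := by
    intro σ u q
    have := ciInf_le (Set.finite_range
      (fun p : (Fin n) × (Fin n → Q) => singleCond μ p.2 p.1 (p.2 p.1))).bddBelow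
      (u, Function.update σ u q)
    simpa [singleCond_update] using this
  have h1 : ∑ u : Fin n, ∑ σ : Fin n → Q, ν σ *
        (∑ q : Q, singleCond ν σ u q * Real.log (singleCond ν σ u q / singleCond μ σ u q))
      ≤ (∑ u : Fin n, ∑ σ : Fin n → Q, ν σ *
        ∑ q, |singleCond ν σ u q - singleCond μ σ u q|) / β := by
    rw [Finset.sum_div]
    refine Finset.sum_le_sum fun u _ => ?_
    rw [Finset.sum_div]
    refine Finset.sum_le_sum fun σ _ => ?_
    rw [mul_div_assoc]
    exact mul_le_mul_of_nonneg_left (aux_kl _ _ β hβ (singleCond_pos ν hνpos σ u)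
      (hβle σ u) (singleCond_sum ν hνpos σ u) (singleCond_sum μ hμpos σ u)) (hνpos σ).le
  have h2 : ωP * (∑ u : Fin n, ∑ σ : Fin n → Q, ν σ *
        ∑ q, |singleCond ν σ u q - singleCond μ σ u q|) ≤ 2 * η := by
    calc _ ≤ ωP * ∑ u : Fin n, ∑ σ : Fin n → Q, ∑ q, |ν σ * singleCond μ σ u q
            - singleCond μ σ u (σ u) * ν (Function.update σ u q)| :=
          mul_le_mul_of_nonneg_left
            (Finset.sum_le_sum fun u _ => aux_tv μ ν hμpos hνpos u) hωP.le
      _ ≤ ∑ u : Fin n, ∑ σ : Fin n → Q, ∑ q, |P (Function.update σ u q) σ * ν σ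
            - P σ (Function.update σ u q) * ν (Function.update σ u q)| := by
          simp only [Finset.mul_sum]
          exact Finset.sum_le_sum fun u _ => Finset.sum_le_sum fun σ _ =>
            Finset.sum_le_sum fun q _ => aux_T P μ hμpos hrev ωP hflip ν σ u q
      _ ≤ ∑ σ, ∑ σ', |P σ' σ * ν σ - P σ σ' * ν σ'| := by
          rw [Finset.sum_comm]
          exact Finset.sum_le_sum fun σ _ =>
            aux_sum σ (fun σ' => |P σ' σ * ν σ - P σ σ' * ν σ'|)
              (fun _ => abs_nonneg _) (by simp)
      _ ≤ 2 * η := by linarith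
  refine h1.trans ?_
  rw [div_le_div_iff₀ hβ (mul_pos hωP hβ)]
  nlinarith [mul_le_mul_of_nonneg_right h2 hβ.le]
end

section
/- Let P be an irreducible reversible Markov chain on a finite state space S with stationary distribution μ, and let G = (S, E) be the graph with edge set E = {(i,j) : P(i|j) ≠ 0}. Then there exist η > 0 and a probability distribution ν on S such that ν is η-metastable with respect to P and the detailed-balance violation of ν satisfies (1/2) Σ_{i,j} |P(j|i)ν(i) − P(i|j)ν(j)| ≥ diam(G) · η / 2, where diam(G) is the diameter of G. -/
open Finset

lemma aux_pow_rel {S : Type*} [Fintype S] [DecidableEq S] (A : Matrix S S ℝ)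
    (R : S → S → Prop) (hr : ∀ i, R i i) (ht : ∀ i j k, R i j → R j k → R i k)
    (hA : ∀ i j, A i j ≠ 0 → R i j) (m : ℕ) : ∀ i j, (A ^ m) i j ≠ 0 → R i j := by
  induction m with
  | zero =>
    intro i j h
    rw [pow_zero, Matrix.one_apply] at h
    by_cases hij : i = j
    · subst hij; exact hr i
    · simp [hij] at h
  | succ k ih =>
    intro i j h
    rw [pow_succ, Matrix.mul_apply] at h
    obtain ⟨l, -, hl⟩ := Finset.exists_ne_zero_of_sum_ne_zero h
    exact ht i l j (ih i l (left_ne_zero_of_mul hl)) (hA l j (right_ne_zero_of_mul hl))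

lemma aux_parts {S : Type*} [Fintype S] (F : S → S → ℝ) (hF : ∀ i j, F i j = - F j i)
    (h : S → ℝ) : 2 * ∑ i, h i * ∑ j, F i j = ∑ i, ∑ j, F i j * (h i - h j) := by
  have e1 : ∑ i, h i * ∑ j, F i j = ∑ i, ∑ j, F i j * h i := by
    simp only [Finset.mul_sum, mul_comm]
  have e2 : ∑ i, ∑ j, F i j * h i = - ∑ i, ∑ j, F i j * h j := by
    rw [Finset.sum_comm, ← Finset.sum_neg_distrib]
    refine Finset.sum_congr rfl fun i _ => ?_
    rw [← Finset.sum_neg_distrib]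
    refine Finset.sum_congr rfl fun j _ => ?_
    rw [hF j i]; ring
  simp only [mul_sub, Finset.sum_sub_distrib]
  rw [e1]; linarith

lemma aux_total {S : Type*} [Fintype S] (F : S → S → ℝ) (hF : ∀ i j, F i j = - F j i) :
    ∑ i, ∑ j, F i j = 0 := by
  have := aux_parts F hF (fun _ => 1)
  simpa using this

lemma aux_poisson {S : Type*} [Fintype S] [DecidableEq S] [Nonempty S]
    (c : S → S → ℝ) (hc0 : ∀ i j, 0 ≤ c i j) (hcs : ∀ i j, c i j = c j i)
    (hconn : ∀ f : S → ℝ, (∀ i j, c i j ≠ 0 → f i = f j) → ∀ i j, f i = f j)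
    (μ : S → ℝ) (hμ1 : ∑ i, μ i = 1) (g : S → ℝ) (hg : ∑ i, g i = 0) :
    ∃ f : S → ℝ, ∑ i, μ i * f i = 0 ∧ ∀ i, ∑ j, c i j * (f i - f j) = g i := by
  let M : (S → ℝ) →ₗ[ℝ] (S → ℝ) :=
    { toFun := fun f i => ∑ j, c i j * (f i - f j) + ∑ j, μ j * f j
      map_add' := by
        intro x y; ext i
        simp only [Pi.add_apply, mul_add, mul_sub, Finset.sum_add_distrib,
          Finset.sum_sub_distrib]
        ring
      map_smul' := by
        intro r x; ext i
        simp only [Pi.smul_apply, smul_eq_mul, RingHom.id_apply, mul_add, Finset.mul_sum]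
        congr 1
        · exact Finset.sum_congr rfl fun j _ => by ring
        · exact Finset.sum_congr rfl fun j _ => by ring }
  have hM : ∀ f i, M f i = ∑ j, c i j * (f i - f j) + ∑ j, μ j * f j := fun _ _ => rfl
  have hanti : ∀ f : S → ℝ, ∀ i j, c i j * (f i - f j) = -(c j i * (f j - f i)) := by
    intro f i j; rw [hcs i j]; ring
  have key : ∀ f : S → ℝ, ∑ i, M f i = 0 → ∑ j, μ j * f j = 0 := by
    intro f h
    simp only [hM, Finset.sum_add_distrib] at h
    rw [aux_total _ (hanti f)] at h
    simpa using h
  have hinj : Function.Injective M := by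
    rw [← LinearMap.ker_eq_bot, LinearMap.ker_eq_bot']
    intro f hf
    have h0 := key f (by simp [hf])
    have hL : ∀ i, ∑ j, c i j * (f i - f j) = 0 := by
      intro i
      have := hM f i
      rw [hf, h0] at this
      simpa using this.symm
    have hD := aux_parts _ (hanti f) f
    simp only [hL, mul_zero, Finset.sum_const_zero] at hD
    have hnn : ∀ i j, 0 ≤ c i j * (f i - f j) * (f i - f j) := by
      intro i j; rw [mul_assoc]; exact mul_nonneg (hc0 i j) (mul_self_nonneg _)
    have hcst := hconn f (by
      intro i j hij
      have h1 := (Finset.sum_eq_zero_iff_of_nonneg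
        (fun i _ => Finset.sum_nonneg fun j _ => hnn i j)).1 hD.symm i (mem_univ i)
      have h2 := (Finset.sum_eq_zero_iff_of_nonneg (fun j _ => hnn i j)).1 h1 j (mem_univ j)
      have h3 : f i - f j = 0 := by
        rcases mul_eq_zero.1 h2 with h | h
        · exact (mul_eq_zero.1 h).resolve_left hij
        · exact h
      linarith)
    ext i
    have : ∑ j, μ j * f j = f i := by
      rw [Finset.sum_congr rfl fun j _ => by rw [hcst j i], ← Finset.sum_mul, hμ1, one_mul]
    simpa [h0] using this.symm
  obtain ⟨f, hf⟩ := (LinearMap.injective_iff_surjective.1 hinj) g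
  have h0 := key f (by rw [hf, hg])
  refine ⟨f, h0, fun i => ?_⟩
  have := hM f i
  rw [hf, h0, add_zero] at this
  exact this.symm

/-- For an irreducible reversible Markov chain `P` on a finite state space
with transition graph `G`, there is an `η`-metastable distribution (for some `η > 0`) whose
detailed-balance violation is at least `diam(G) · η / 2`. -/
theorem exists_metastable_with_large_detailed_balance_violation
    {S : Type*} [Fintype S] [DecidableEq S] [Nonempty S]
    (P : S → S → ℝ) (hP0 : ∀ i j, 0 ≤ P i j) (hP1 : ∀ j, ∑ i, P i j = 1)
    (μ : S → ℝ) (hμ0 : ∀ i, 0 ≤ μ i) (hμ1 : ∑ i, μ i = 1)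
    (hrev : ∀ i j, P i j * μ j = P j i * μ i)
    (hirr : ∀ i j : S, ∃ m : ℕ, 0 < ((Matrix.of fun i j => P i j) ^ m) i j)
    (G : SimpleGraph S)
    (hG : ∀ i j, G.Adj i j ↔ i ≠ j ∧ (P i j ≠ 0 ∨ P j i ≠ 0)) :
    ∃ (η : ℝ) (ν : S → ℝ), 0 < η ∧ (∀ i, 0 ≤ ν i) ∧ (∑ i, ν i = 1) ∧
      (1 / 2) * ∑ i, |ν i - ∑ j, P i j * ν j| ≤ η ∧
      (1 / 2) * ∑ i, ∑ j, |P j i * ν i - P i j * ν j| ≥ (G.diam : ℝ) * η / 2 := by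
  have hstat : ∀ i, ∑ j, P i j * μ j = μ i := by
    intro i
    simp only [hrev i, ← Finset.sum_mul, hP1, one_mul]
  have hμpos : ∀ i, 0 < μ i := by
    intro i
    refine lt_of_le_of_ne (hμ0 i) fun hi => ?_
    obtain ⟨k, -, hk⟩ := Finset.exists_ne_zero_of_sum_ne_zero
      (s := univ) (f := μ) (by rw [hμ1]; exact one_ne_zero)
    obtain ⟨m, hm⟩ := hirr i k
    refine hk ((aux_pow_rel _ (fun i j => μ i = 0 → μ j = 0) (fun _ h => h)
      (fun _ _ _ h1 h2 h => h2 (h1 h)) ?_ m i k hm.ne') hi.symm)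
    intro x y hxy hx
    have := hrev x y
    rw [hx, mul_zero] at this
    exact (mul_eq_zero.1 this).resolve_left hxy
  have hGconn : G.Connected := by
    rw [SimpleGraph.connected_iff]
    refine ⟨fun i j => ?_, inferInstance⟩
    obtain ⟨m, hm⟩ := hirr i j
    refine aux_pow_rel _ G.Reachable (fun i => SimpleGraph.Reachable.refl i)
      (fun _ _ _ h1 h2 => h1.trans h2) ?_ m i j hm.ne'
    intro x y hxy
    by_cases h : x = y
    · subst h; exact SimpleGraph.Reachable.refl x
    · exact ((hG x y).2 ⟨h, Or.inl hxy⟩).reachable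
  obtain ⟨a, b, hab⟩ := G.exists_dist_eq_diam
  obtain ⟨f, hf0, hf⟩ := aux_poisson (fun i j => P i j * μ j)
    (fun i j => mul_nonneg (hP0 i j) (hμ0 j)) hrev
    (by
      intro f h i j
      obtain ⟨m, hm⟩ := hirr i j
      exact aux_pow_rel _ (fun i j => f i = f j) (fun _ => rfl) (fun _ _ _ h1 h2 => h1.trans h2)
        (fun x y hxy => h x y (mul_ne_zero hxy (hμpos y).ne')) m i j hm.ne')
    μ hμ1 (fun i => (if i = b then 1 else 0) - (if i = a then 1 else 0))
    (by simp)
  have hs0 : 0 ≤ ∑ i, |f i| := Finset.sum_nonneg fun i _ => abs_nonneg _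
  obtain ⟨ε, hε, hεf⟩ : ∃ ε : ℝ, 0 < ε ∧ ε * ∑ i, |f i| ≤ 1 := by
    refine ⟨(1 + ∑ i, |f i|)⁻¹, by positivity, ?_⟩
    rw [inv_mul_le_iff₀ (by positivity)]; linarith
  have hflow : ∀ i j, P j i * (μ i * (1 + ε * f i)) - P i j * (μ j * (1 + ε * f j))
      = ε * (P i j * μ j * (f i - f j)) := by
    intro i j
    linear_combination (-1 - ε * f i) * hrev i j
  refine ⟨ε, fun i => μ i * (1 + ε * f i), hε, fun i => ?_, ?_, ?_, ?_⟩
  · refine mul_nonneg (hμ0 i) ?_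
    have h1 : |f i| ≤ ∑ i, |f i| :=
      Finset.single_le_sum (f := fun i => |f i|) (fun i _ => abs_nonneg _) (mem_univ i)
    have h2 := mul_le_mul_of_nonneg_left h1 hε.le
    have h3 := mul_le_mul_of_nonneg_left (neg_abs_le (f i)) hε.le
    linarith
  · have : ∀ i, μ i * (1 + ε * f i) = μ i + ε * (μ i * f i) := fun i => by ring
    simp only [this, Finset.sum_add_distrib, ← Finset.mul_sum, hf0, hμ1]
    ring
  · have hd : ∀ i, μ i * (1 + ε * f i) - ∑ j, P i j * (μ j * (1 + ε * f j))
        = ε * ((if i = b then 1 else 0) - (if i = a then 1 else 0)) := by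
      intro i
      rw [← hf i, Finset.mul_sum, ← Finset.sum_congr rfl fun j _ => hflow i j,
        Finset.sum_sub_distrib, ← Finset.sum_mul, hP1, one_mul]
    have hle : ∀ i, |μ i * (1 + ε * f i) - ∑ j, P i j * (μ j * (1 + ε * f j))|
        ≤ ε * ((if i = b then 1 else 0) + (if i = a then 1 else 0)) := by
      intro i
      rw [hd i, abs_mul, abs_of_pos hε]
      refine mul_le_mul_of_nonneg_left ?_ hε.le
      split_ifs <;> norm_num
    have hsum := Finset.sum_le_sum fun i (_ : i ∈ univ) => hle i
    rw [← Finset.mul_sum, Finset.sum_add_distrib] at hsum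
    simp only [Finset.sum_ite_eq', mem_univ, if_true] at hsum
    linarith
  · simp only [hflow, abs_mul ε, abs_of_pos hε, ← Finset.mul_sum]
    have hp := aux_parts (fun i j => P i j * μ j * (f i - f j))
      (by intro i j; simp only [hrev i j]; ring) (fun i => (G.dist a i : ℝ))
    simp only [hf] at hp
    have hl : ∑ i, (G.dist a i : ℝ) * ((if i = b then 1 else 0) - (if i = a then 1 else 0))
        = G.diam := by
      simp [mul_sub, Finset.sum_sub_distrib, hab]
    rw [hl] at hp
    have hb : ∑ i, ∑ j, P i j * μ j * (f i - f j) * ((G.dist a i : ℝ) - G.dist a j)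
        ≤ ∑ i, ∑ j, |P i j * μ j * (f i - f j)| := by
      refine Finset.sum_le_sum fun i _ => Finset.sum_le_sum fun j _ => ?_
      by_cases hij : G.Adj i j
      · refine (le_abs_self _).trans ?_
        rw [abs_mul]
        refine mul_le_of_le_one_right (abs_nonneg _) ?_
        have h1 := hGconn.dist_triangle (u := a) (v := i) (w := j)
        have h2 := hGconn.dist_triangle (u := a) (v := j) (w := i)
        rw [SimpleGraph.dist_eq_one_iff_adj.2 hij] at h1
        rw [SimpleGraph.dist_eq_one_iff_adj.2 hij.symm] at h2
        have h1' : (G.dist a j : ℝ) ≤ G.dist a i + 1 := by exact_mod_cast h1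
        have h2' : (G.dist a i : ℝ) ≤ G.dist a j + 1 := by exact_mod_cast h2
        rw [abs_le]; constructor <;> linarith
      · have hz : P i j * μ j * (f i - f j) = 0 := by
          by_cases h : i = j
          · subst h; simp
          · have : P i j = 0 := by
              by_contra h'
              exact hij ((hG i j).2 ⟨h, Or.inl h'⟩)
            simp [this]
        simp [hz]
    have hdn : (0 : ℝ) ≤ G.diam := Nat.cast_nonneg _
    have hfin := mul_le_mul_of_nonneg_left (hp.le.trans hb) hε.le
    have := mul_nonneg hdn hε.le
    simp only [abs_mul, ← Finset.mul_sum] at hfin ⊢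
    linarith
end

section
/- Let P be an irreducible row-stochastic Markov chain on a finite state space S, and let s ≠ t be two states in S. Then there exist η > 0 and a probability distribution ν on S such that ν(I − P) = (η/2)(e_s − e_t), i.e. ν(i) − Σ_j P(i|j)ν(j) equals η/2 for i = s, equals −η/2 for i = t, and equals 0 for all other i. -/
open Finset

lemma aux_zero {S : Type*} [Fintype S] [DecidableEq S]
    (P : S → S → ℝ) (hP0 : ∀ i j, 0 ≤ P i j) (hP1 : ∀ j, ∑ i, P i j = 1)
    (hirr : ∀ i j : S, ∃ m : ℕ, 0 < ((Matrix.of fun i j => P i j) ^ m) i j)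
    (t : S) (y : S → ℝ) (hy : ∀ i, 0 ≤ y i) (hyt : y t = 0)
    (hle : ∀ i, y i ≤ ∑ j, P i j * y j) : ∀ j, y j = 0 := by
  have hsum : ∑ i, y i = ∑ i, ∑ j, P i j * y j := by
    rw [Finset.sum_comm]
    refine Finset.sum_congr rfl fun j _ => ?_
    rw [← Finset.sum_mul, hP1, one_mul]
  have heq : ∀ i, y i = ∑ j, P i j * y j := fun i =>
    (Finset.sum_eq_sum_iff_of_le (fun i _ => hle i)).1 hsum i (Finset.mem_univ i)
  set A : Matrix S S ℝ := Matrix.of fun i j => P i j with hA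
  have hAy : A.mulVec y = y := by
    funext i
    exact (heq i).symm
  have hpow : ∀ m : ℕ, (A ^ m).mulVec y = y := by
    intro m
    induction m with
    | zero => simp
    | succ k ih => rw [pow_succ, ← Matrix.mulVec_mulVec, hAy, ih]
  have hnn : ∀ m : ℕ, ∀ i j, 0 ≤ (A ^ m) i j := by
    intro m
    induction m with
    | zero =>
      intro i j
      rw [pow_zero, Matrix.one_apply]
      split_ifs <;> norm_num
    | succ k ih =>
      intro i j
      rw [pow_succ, Matrix.mul_apply]
      exact Finset.sum_nonneg fun l _ => mul_nonneg (ih i l) (hP0 l j)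
  intro j
  obtain ⟨m, hm⟩ := hirr t j
  have h0 : ∑ l, (A ^ m) t l * y l = 0 := by
    have := congrFun (hpow m) t
    rw [hyt] at this
    exact this
  have h1 := (Finset.sum_eq_zero_iff_of_nonneg
    (fun l _ => mul_nonneg (hnn m t l) (hy l))).1 h0 j (Finset.mem_univ j)
  exact (mul_eq_zero.1 h1).resolve_left hm.ne'

/-- For an irreducible row-stochastic Markov chain `P` on a finite state
space and distinct states `s ≠ t`, there exist `η > 0` and a probability distribution `ν` with
`ν(I − P) = (η/2)(e_s − e_t)`. -/
theorem exists_source_sink_metastable {S : Type*} [Fintype S] [DecidableEq S]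
    (P : S → S → ℝ) (hP0 : ∀ i j, 0 ≤ P i j) (hP1 : ∀ j, ∑ i, P i j = 1)
    (hirr : ∀ i j : S, ∃ m : ℕ, 0 < ((Matrix.of fun i j => P i j) ^ m) i j)
    (s t : S) (hst : s ≠ t) :
    ∃ (η : ℝ) (ν : S → ℝ), 0 < η ∧ (∀ i, 0 ≤ ν i) ∧ (∑ i, ν i = 1) ∧
      ∀ i, ν i - ∑ j, P i j * ν j =
        if i = s then η / 2 else if i = t then -(η / 2) else 0 := by
  classical
  let M : Matrix S S ℝ := Matrix.of fun i j => if i = t then 0 else P i j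
  have hMt : ∀ x : S → ℝ, M.mulVec x t = 0 := by
    intro x
    simp [M, Matrix.mulVec, dotProduct]
  have hMn : ∀ (x : S → ℝ) i, i ≠ t → M.mulVec x i = ∑ j, P i j * x j := by
    intro x i hi
    simp [M, Matrix.mulVec, dotProduct, hi]
  have hinj : Function.Injective (Matrix.mulVecLin (1 - M)) := by
    rw [injective_iff_map_eq_zero]
    intro x hx
    have hx' : ∀ i, x i = M.mulVec x i := by
      intro i
      have := congrFun hx i
      simp only [Matrix.mulVecLin_apply, Matrix.sub_mulVec, Matrix.one_mulVec, Pi.sub_apply,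
        Pi.zero_apply] at this
      linarith
    have hxt : x t = 0 := by rw [hx', hMt]
    have := aux_zero P hP0 hP1 hirr t (fun i => |x i|) (fun i => abs_nonneg _) (by simp [hxt]) (by
      intro i
      by_cases hi : i = t
      · subst hi
        simp only [hxt, abs_zero]
        exact Finset.sum_nonneg fun j _ => mul_nonneg (hP0 _ _) (abs_nonneg _)
      · calc |x i| = |∑ j, P i j * x j| := by rw [← hMn x i hi, ← hx' i]
          _ ≤ ∑ j, |P i j * x j| := Finset.abs_sum_le_sum_abs _ _
          _ = _ := Finset.sum_congr rfl fun j _ => by rw [abs_mul, abs_of_nonneg (hP0 i j)])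
    funext i
    exact abs_eq_zero.1 (this i)
  obtain ⟨v, hv⟩ := (LinearMap.injective_iff_surjective.1 hinj) (Pi.single s 1)
  have hv' : ∀ i, v i - M.mulVec v i = if i = s then 1 else 0 := by
    intro i
    have := congrFun hv i
    simp only [Matrix.mulVecLin_apply, Matrix.sub_mulVec, Matrix.one_mulVec, Pi.sub_apply,
      Pi.single_apply] at this
    exact this
  have hvt : v t = 0 := by
    have := hv' t
    rw [hMt, if_neg hst.symm] at this
    linarith
  have hvn : ∀ i, i ≠ t → v i - ∑ j, P i j * v j = if i = s then 1 else 0 := by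
    intro i hi
    rw [← hMn v i hi]
    exact hv' i
  have hneg := aux_zero P hP0 hP1 hirr t (fun i => max (-v i) 0) (fun i => le_max_right _ _)
    (by simp [hvt]) (by
      intro i
      have hnn : 0 ≤ ∑ j, P i j * max (-v j) 0 :=
        Finset.sum_nonneg fun j _ => mul_nonneg (hP0 _ _) (le_max_right _ _)
      refine max_le ?_ hnn
      by_cases hi : i = t
      · subst hi
        rw [hvt, neg_zero]
        exact hnn
      · have h1 := hvn i hi
        have h2 : -(∑ j, P i j * v j) ≤ ∑ j, P i j * max (-v j) 0 := by
          rw [← Finset.sum_neg_distrib]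
          refine Finset.sum_le_sum fun j _ => ?_
          rw [← mul_neg]
          exact mul_le_mul_of_nonneg_left (le_max_left _ _) (hP0 _ _)
        have h3 : (0:ℝ) ≤ if i = s then 1 else 0 := by split_ifs <;> norm_num
        linarith)
  have hv0 : ∀ i, 0 ≤ v i := by
    intro i
    have h1 : max (-v i) 0 = 0 := hneg i
    have h2 := le_max_left (-v i) 0
    linarith
  have hvs : 1 ≤ v s := by
    have h1 := hvn s hst
    rw [if_pos rfl] at h1
    have : 0 ≤ ∑ j, P s j * v j := Finset.sum_nonneg fun j _ => mul_nonneg (hP0 _ _) (hv0 _)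
    linarith
  have hN : 0 < ∑ i, v i := by
    have := Finset.single_le_sum (fun i _ => hv0 i) (Finset.mem_univ s)
    linarith
  have htot : ∑ i, (v i - ∑ j, P i j * v j) = 0 := by
    rw [Finset.sum_sub_distrib, Finset.sum_comm (f := fun i j => P i j * v j), sub_eq_zero]
    refine Finset.sum_congr rfl fun j _ => ?_
    rw [← Finset.sum_mul, hP1, one_mul]
  have hat : v t - ∑ j, P t j * v j = -1 := by
    rw [← Finset.add_sum_erase _ _ (Finset.mem_univ t)] at htot
    have : ∑ i ∈ Finset.univ.erase t, (v i - ∑ j, P i j * v j) = 1 := by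
      rw [Finset.sum_congr rfl fun i hi => hvn i (Finset.ne_of_mem_erase hi)]
      simp [hst]
    linarith
  set N := ∑ i, v i with hNdef
  refine ⟨2 / N, fun i => v i / N, by positivity, fun i => div_nonneg (hv0 i) hN.le, ?_, ?_⟩
  · rw [← Finset.sum_div]
    exact div_self hN.ne'
  · intro i
    have h1 : v i / N - ∑ j, P i j * (v j / N) = (v i - ∑ j, P i j * v j) / N := by
      rw [sub_div, Finset.sum_div]
      congr 1
      exact Finset.sum_congr rfl fun j _ => by ring
    rw [h1]
    by_cases hi : i = t
    · subst hi
      rw [hat, if_neg hst.symm, if_pos rfl]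
      field_simp
    · rw [hvn i hi]
      split_ifs
      · field_simp
      · simp
end

section
/- Let L be an even positive integer and let P be the simple random walk on the cycle graph on state space [L] (P(i±1 mod L | i) = 1/2). Define the tent distribution ν(i) = (1/Z)·(iL) for i ≤ L/2 and ν(i) = (1/Z)·(−iL + L²) for i > L/2, where Z is the normalizing constant. Then ν is (2L/Z)-metastable with respect to P, while its detailed-balance violation satisfies (1/2) Σ_{i,j∈[L]} |P(i|j)ν(j) − P(j|i)ν(i)| = L²/(2Z). -/
open Finset

/-- The unnormalized tent function on `[L] = {1, …, L}` (state `i : Fin L` represents `i+1`):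
`tent(i) = i·L` for `i ≤ L/2` and `tent(i) = −i·L + L²` for `i > L/2`. -/
noncomputable def tent (L : ℕ) (i : Fin L) : ℝ :=
  if (i.val + 1) ≤ L / 2 then ((i.val + 1 : ℕ) : ℝ) * L
  else -(((i.val + 1 : ℕ) : ℝ) * L) + (L : ℝ) ^ 2

lemma val_succ_cyc (L : ℕ) [NeZero L] (i : Fin L) :
    (i + 1).val = if i.val + 1 < L then i.val + 1 else 0 := by
  have h := i.isLt
  have h1 : (i + 1).val = (i.val + 1) % L := by
    rw [Fin.val_add, Fin.coe_ofNat_eq_mod, Nat.add_mod_mod]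
  rw [h1]
  split_ifs with h2
  · exact Nat.mod_eq_of_lt h2
  · have : i.val + 1 = L := by omega
    rw [this, Nat.mod_self]

lemma tent_step (m : ℕ) [NeZero (m + m)] (i : Fin (m + m)) :
    tent (m + m) (i + 1) - tent (m + m) i =
      if m ≤ i.val + 1 ∧ i.val + 1 < m + m then -((m + m : ℕ) : ℝ) else ((m + m : ℕ) : ℝ) := by
  have h := i.isLt
  have hm : (m + m) / 2 = m := by omega
  unfold tent
  rw [val_succ_cyc, hm]
  by_cases h2 : i.val + 1 < m + m
  · simp only [h2, if_true, and_true]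
    by_cases h3 : i.val + 1 + 1 ≤ m
    · rw [if_pos h3, if_pos (by omega), if_neg (by omega)]; push_cast; ring
    · by_cases h4 : i.val + 1 ≤ m
      · have h5 : (m : ℝ) = i.val + 1 := by
          have : m = i.val + 1 := by omega
          exact_mod_cast this
        rw [if_neg h3, if_pos h4, if_pos (by omega)]; push_cast; rw [h5]; ring
      · rw [if_neg h3, if_neg h4, if_pos (by omega)]; push_cast; ring
  · have h5 : (i.val : ℝ) + 1 = m + m := by
      have : i.val + 1 = m + m := by omega
      exact_mod_cast this
    rw [if_neg h2, if_pos (by omega), if_neg (by omega), if_neg (by omega)]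
    push_cast; rw [h5]; ring

lemma tent_step_abs (m : ℕ) [NeZero (m + m)] (i : Fin (m + m)) :
    |tent (m + m) (i + 1) - tent (m + m) i| = ((m + m : ℕ) : ℝ) := by
  rw [tent_step]
  split_ifs
  · rw [abs_neg, abs_of_nonneg (Nat.cast_nonneg _)]
  · rw [abs_of_nonneg (Nat.cast_nonneg _)]

lemma tent_second (m : ℕ) [NeZero (m + m)] (hm : m - 1 < m + m) (hm' : m + m - 1 < m + m)
    (i : Fin (m + m)) :
    |tent (m + m) i - (tent (m + m) (i - 1) + tent (m + m) (i + 1)) / 2| ≤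
      (if i = ⟨m - 1, hm⟩ then ((m + m : ℕ) : ℝ) else 0) +
      (if i = ⟨m + m - 1, hm'⟩ then ((m + m : ℕ) : ℝ) else 0) := by
  obtain ⟨j, rfl⟩ : ∃ j, i = j + 1 := ⟨i - 1, by simp⟩
  have h1 := tent_step m j
  have h2 := tent_step m (j + 1)
  have hv := val_succ_cyc (m + m) j
  have hj := j.isLt
  rw [add_sub_cancel_right]
  have e : tent (m + m) (j + 1) - (tent (m + m) j + tent (m + m) (j + 1 + 1)) / 2 =
      ((tent (m + m) (j + 1) - tent (m + m) j)
        - (tent (m + m) (j + 1 + 1) - tent (m + m) (j + 1))) / 2 := by ring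
  rw [e, h1, h2]
  simp only [Fin.ext_iff]
  rw [hv]
  have hc : (0 : ℝ) ≤ ((m + m : ℕ) : ℝ) := Nat.cast_nonneg _
  generalize ((m + m : ℕ) : ℝ) = c at hc
  rw [abs_le]
  split_ifs <;> first | (exfalso; omega) | (constructor <;> linarith)

lemma tent_nonneg (L : ℕ) (i : Fin L) : 0 ≤ tent L i := by
  unfold tent
  split_ifs
  · positivity
  · have h : ((i.val + 1 : ℕ) : ℝ) ≤ L := by exact_mod_cast i.isLt
    have : (0 : ℝ) ≤ L := Nat.cast_nonneg _
    nlinarith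

/-- For the simple random walk `P` on the cycle on an even number `L` of
states, the normalized tent distribution `ν` is `(2L/Z)`-metastable while its detailed-balance
violation equals `L²/(2Z)`. -/
theorem tent_metastable_vs_strong (L : ℕ) [NeZero L] (hL : 0 < L) (hLeven : Even L)
    (P : Fin L → Fin L → ℝ)
    (hP : ∀ i j : Fin L,
      P i j = (if i = j + 1 then (1 : ℝ) / 2 else 0) + (if i = j - 1 then (1 : ℝ) / 2 else 0))
    (Z : ℝ) (hZ : Z = ∑ i : Fin L, tent L i)
    (ν : Fin L → ℝ) (hν : ∀ i, ν i = tent L i / Z) :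
    (1 / 2) * ∑ i : Fin L, |ν i - ∑ j : Fin L, P i j * ν j| ≤ 2 * (L : ℝ) / Z ∧
    (1 / 2) * ∑ i : Fin L, ∑ j : Fin L, |P i j * ν j - P j i * ν i| = (L : ℝ) ^ 2 / (2 * Z) := by
  obtain ⟨m, rfl⟩ := hLeven
  have hZ0 : 0 ≤ Z := by rw [hZ]; exact Finset.sum_nonneg fun i _ => tent_nonneg _ i
  have hsum : ∀ (i : Fin (m + m)) (f : Fin (m + m) → ℝ),
      ∑ j, P i j * f j = (f (i - 1) + f (i + 1)) / 2 := by
    intro i f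
    have : ∀ j, P i j * f j =
        (if j = i - 1 then f j / 2 else 0) + (if j = i + 1 then f j / 2 else 0) := by
      intro j
      rw [hP]
      have e1 : i = j + 1 ↔ j = i - 1 := by rw [eq_sub_iff_add_eq, eq_comm]
      have e2 : i = j - 1 ↔ j = i + 1 := by rw [eq_sub_iff_add_eq, eq_comm]
      simp only [e1, e2]
      split_ifs <;> ring
    simp only [this, Finset.sum_add_distrib, Finset.sum_ite_eq', Finset.mem_univ, if_true]
    ring
  have hsymm : ∀ i j, P j i = P i j := by
    intro i j
    rw [hP, hP]
    have e1 : i = j + 1 ↔ j = i - 1 := by rw [eq_sub_iff_add_eq, eq_comm]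
    have e2 : i = j - 1 ↔ j = i + 1 := by rw [eq_sub_iff_add_eq, eq_comm]
    simp only [e1, e2]
    ring
  have hPn : ∀ i j, 0 ≤ P i j := by
    intro i j
    rw [hP]
    positivity
  constructor
  · have hb : ∀ i, |ν i - ∑ j, P i j * ν j| ≤
        ((if i = ⟨m - 1, by omega⟩ then ((m + m : ℕ) : ℝ) else 0) +
        (if i = ⟨m + m - 1, by omega⟩ then ((m + m : ℕ) : ℝ) else 0)) / Z := by
      intro i
      rw [hsum, hν, hν, hν]
      have : tent (m + m) i / Z - (tent (m + m) (i - 1) / Z + tent (m + m) (i + 1) / Z) / 2 =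
        (tent (m + m) i - (tent (m + m) (i - 1) + tent (m + m) (i + 1)) / 2) / Z := by ring
      rw [this, abs_div, abs_of_nonneg hZ0]
      exact div_le_div_of_nonneg_right (tent_second m _ _ i) hZ0
    have hs := Finset.sum_le_sum fun i (_ : i ∈ Finset.univ) => hb i
    rw [← Finset.sum_div, Finset.sum_add_distrib] at hs
    simp only [Finset.sum_ite_eq', Finset.mem_univ, if_true] at hs
    have hq : 0 ≤ ((m + m : ℕ) : ℝ) / Z := div_nonneg (Nat.cast_nonneg _) hZ0
    rw [add_div] at hs
    rw [mul_div_assoc]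
    linarith
  · have hi : ∀ i, ∑ j, |P i j * ν j - P j i * ν i| = ((m + m : ℕ) : ℝ) / Z := by
      intro i
      have : ∀ j, |P i j * ν j - P j i * ν i| = P i j * |ν j - ν i| := by
        intro j
        rw [hsymm i j, ← mul_sub, abs_mul, abs_of_nonneg (hPn i j)]
      simp only [this]
      rw [hsum i (fun j => |ν j - ν i|)]
      simp only [hν, ← sub_div, abs_div, abs_of_nonneg hZ0]
      have h1 := tent_step_abs m (i - 1)
      rw [sub_add_cancel, abs_sub_comm] at h1
      rw [h1, tent_step_abs]
      ring
    simp only [hi, Finset.sum_const, Finset.card_univ, Fintype.card_fin, nsmul_eq_mul]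
    rw [mul_comm 2 Z, ← div_div]
    ring
end

section
/- Let μ be an Ising model on n spins with parameters θ*, the stationary distribution of a reversible Markov chain P on {−1,1}^n satisfying the bounded spin-flip condition with constant ω_P, and let ν be a strictly positive η-strongly metastable distribution of P. For a site u, let L(θ_u) = E_{σ∼ν} log(1 + exp(−2σ_u(Σ_{k≠u} θ_{uk} σ_k + θ_u))) be the population pseudo-likelihood loss. Then the gradient of L at the true parameters is small: ‖∇L(θ*_u)‖_∞ ≤ 4η/ω_P, i.e. |∂L(θ*_u)/∂θ_{uk}| ≤ 4η/ω_P for every k ≠ u and |∂L(θ*_u)/∂θ_u| ≤ 4η/ω_P. -/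
open Finset

/-- The real spin value `±1` of a Boolean spin. -/
noncomputable def spin (b : Bool) : ℝ := if b then 1 else -1

/-- The Ising energy `E*(σ) = Σ_{i<j} J_{ij} σ_i σ_j + Σ_i h_i σ_i`. -/
noncomputable def isingEnergy {n : ℕ} (J : Fin n → Fin n → ℝ) (h : Fin n → ℝ)
    (σ : Fin n → Bool) : ℝ :=
  (∑ i : Fin n, ∑ j : Fin n, if i < j then J i j * spin (σ i) * spin (σ j) else 0) +
    ∑ i : Fin n, h i * spin (σ i)

/-- The Ising Gibbs distribution `μ(σ) ∝ exp(E*(σ))`. -/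
noncomputable def isingGibbs {n : ℕ} (J : Fin n → Fin n → ℝ) (h : Fin n → ℝ)
    (σ : Fin n → Bool) : ℝ :=
  Real.exp (isingEnergy J h σ) / ∑ σ' : Fin n → Bool, Real.exp (isingEnergy J h σ')

/-- Single-variable conditional `ν(q | σ_{∖u})` for a distribution on `{−1,1}^n`. -/
noncomputable def boolCond {n : ℕ} (ν : (Fin n → Bool) → ℝ) (σ : Fin n → Bool)
    (u : Fin n) (q : Bool) : ℝ :=
  ν (Function.update σ u q) / (ν (Function.update σ u true) + ν (Function.update σ u false))

/-- Site-`u` pseudo-likelihood loss for Ising models. -/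
noncomputable def plIsing {n : ℕ} (u : Fin n) (θh : ℝ) (θJ : Fin n → ℝ)
    (σ : Fin n → Bool) : ℝ :=
  Real.log (1 + Real.exp (-2 * spin (σ u) *
    ((∑ v ∈ Finset.univ.erase u, θJ v * spin (σ v)) + θh)))

/-- Population pseudo-likelihood loss at site `u` under the data distribution `ν`. -/
noncomputable def popPL {n : ℕ} (ν : (Fin n → Bool) → ℝ) (u : Fin n)
    (θh : ℝ) (θJ : Fin n → ℝ) : ℝ :=
  ∑ σ : Fin n → Bool, ν σ * plIsing u θh θJ σ


/-- Flip of the spin at `u`. -/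
def flipAt {n : ℕ} (u : Fin n) (σ : Fin n → Bool) : Fin n → Bool :=
  Function.update σ u (!σ u)

lemma flipAt_flipAt {n : ℕ} (u : Fin n) (σ : Fin n → Bool) :
    flipAt u (flipAt u σ) = σ := by
  simp [flipAt]

lemma spin_not (b : Bool) : spin (!b) = - spin b := by
  cases b <;> simp [spin]

lemma abs_spin (b : Bool) : |spin b| = 1 := by
  cases b <;> simp [spin]

lemma spin_flipAt {n : ℕ} (u : Fin n) (σ : Fin n → Bool) (v : Fin n) :
    spin (flipAt u σ v) = if v = u then - spin (σ u) else spin (σ v) := by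
  by_cases h : v = u
  · subst h; simp [flipAt, spin_not]
  · simp [flipAt, h]

/-- The local field. -/
noncomputable def locField {n : ℕ} (J : Fin n → Fin n → ℝ) (h : Fin n → ℝ) (u : Fin n)
    (σ : Fin n → Bool) : ℝ :=
  (∑ v ∈ Finset.univ.erase u, J u v * spin (σ v)) + h u

lemma energy_flip {n : ℕ} (J : Fin n → Fin n → ℝ) (h : Fin n → ℝ)
    (hJsymm : ∀ i j, J i j = J j i) (u : Fin n) (σ : Fin n → Bool) :
    isingEnergy J h (flipAt u σ) =
      isingEnergy J h σ + -2 * spin (σ u) * locField J h u σ := by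
  have key : ∀ i j : Fin n,
      (if i < j then J i j * spin (flipAt u σ i) * spin (flipAt u σ j) else 0) =
      (if i < j then J i j * spin (σ i) * spin (σ j) else 0)
      + ((if i = u then (if u < j then -2 * spin (σ u) * (J u j * spin (σ j)) else 0) else 0)
      + (if j = u then (if i < u then -2 * spin (σ u) * (J u i * spin (σ i)) else 0) else 0)) := by
    intro i j
    rw [spin_flipAt, spin_flipAt]
    by_cases hi : i = u
    · subst hi
      by_cases hj : j = i
      · subst hj; simp
      · by_cases hl : i < j
        · simp [hj, hl]; ring
        · simp [hj, hl]
    · by_cases hj : j = u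
      · subst hj
        rw [hJsymm j i]
        by_cases hl : i < j
        · simp [hi, hl]; ring
        · simp [hi, hl]
      · simp [hi, hj]
  have key2 : ∀ i : Fin n, h i * spin (flipAt u σ i) = h i * spin (σ i) +
      (if i = u then -2 * spin (σ u) * h u else 0) := by
    intro i
    rw [spin_flipAt]
    by_cases hi : i = u
    · subst hi; simp; ring
    · simp [hi]
  have key3 : ∑ v ∈ Finset.univ.erase u, J u v * spin (σ v) =
      (∑ j, if u < j then J u j * spin (σ j) else 0) +
      ∑ j, if j < u then J u j * spin (σ j) else 0 := by
    rw [← Finset.sum_add_distrib, ← Finset.filter_ne' Finset.univ u, Finset.sum_filter]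
    refine Finset.sum_congr rfl fun j _ => ?_
    rcases lt_trichotomy u j with hl | hl | hl
    · simp [hl, hl.ne', hl.not_gt]
    · simp [hl]
    · simp [hl, hl.ne, hl.not_gt]
  have e1 : (∑ i : Fin n, ∑ j : Fin n,
      if i = u then (if u < j then -2 * spin (σ u) * (J u j * spin (σ j)) else 0) else 0)
      = -2 * spin (σ u) * ∑ j, if u < j then J u j * spin (σ j) else 0 := by
    rw [Finset.sum_comm, Finset.mul_sum]
    refine Finset.sum_congr rfl fun j _ => ?_
    rw [Finset.sum_ite_eq' Finset.univ u]
    simp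
  have e2 : (∑ i : Fin n, ∑ j : Fin n,
      if j = u then (if i < u then -2 * spin (σ u) * (J u i * spin (σ i)) else 0) else 0)
      = -2 * spin (σ u) * ∑ j, if j < u then J u j * spin (σ j) else 0 := by
    rw [Finset.mul_sum]
    refine Finset.sum_congr rfl fun j _ => ?_
    rw [Finset.sum_ite_eq' Finset.univ u]
    simp
  unfold isingEnergy locField
  simp only [key, key2, Finset.sum_add_distrib]
  rw [e1, e2, key3, Finset.sum_ite_eq' Finset.univ u]
  simp only [Finset.mem_univ, if_true]
  ring

lemma sum_flipAt {n : ℕ} (u : Fin n) (f : (Fin n → Bool) → ℝ) :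
    ∑ σ, f (flipAt u σ) = ∑ σ, f σ :=
  Equiv.sum_comp (Function.Involutive.toPerm (flipAt u) (flipAt_flipAt u)) f

lemma hasDeriv_pop {n : ℕ} (ν : (Fin n → Bool) → ℝ) (u : Fin n)
    (m g : (Fin n → Bool) → ℝ) (t0 : ℝ) :
    HasDerivAt (fun t : ℝ => ∑ σ, ν σ *
      Real.log (1 + Real.exp (-2 * spin (σ u) * (m σ + (t - t0) * g σ))))
      (∑ σ, ν σ * (Real.exp (-2 * spin (σ u) * m σ) * (-2 * spin (σ u) * g σ) /
        (1 + Real.exp (-2 * spin (σ u) * m σ)))) t0 := by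
  apply HasDerivAt.fun_sum
  intro σ _
  apply HasDerivAt.const_mul
  have h1 : HasDerivAt (fun t : ℝ => -2 * spin (σ u) * (m σ + (t - t0) * g σ))
      (-2 * spin (σ u) * g σ) t0 := by
    have := (((((hasDerivAt_id t0).sub_const t0).mul_const (g σ)).const_add (m σ)).const_mul
      (-2 * spin (σ u)))
    simpa using this
  have h2 := (h1.exp.const_add 1).log (by positivity)
  simpa using h2

lemma main_bound {n : ℕ}
    (J : Fin n → Fin n → ℝ) (hfield : Fin n → ℝ)
    (hJsymm : ∀ i j, J i j = J j i)
    (μ : (Fin n → Bool) → ℝ) (hμ : ∀ σ, μ σ = isingGibbs J hfield σ)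
    (P : (Fin n → Bool) → (Fin n → Bool) → ℝ)
    (hrev : ∀ σ σ', P σ' σ * μ σ = P σ σ' * μ σ')
    (ωP : ℝ) (hωP : 0 < ωP)
    (hflip : ∀ (σ : Fin n → Bool) (u : Fin n) (q : Bool),
      P (Function.update σ u q) σ / boolCond μ σ u q ≥ ωP)
    (ν : (Fin n → Bool) → ℝ)
    (η : ℝ)
    (hmeta : (1 / 2) * ∑ σ, ∑ σ', |P σ' σ * ν σ - P σ σ' * ν σ'| ≤ η)
    (u : Fin n) (g : (Fin n → Bool) → ℝ) (hg : ∀ σ, g (flipAt u σ) = g σ)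
    (hg1 : ∀ σ, |g σ| = 1) :
    |∑ σ, ν σ * (Real.exp (-2 * spin (σ u) * locField J hfield u σ) *
      (-2 * spin (σ u) * g σ) /
        (1 + Real.exp (-2 * spin (σ u) * locField J hfield u σ)))| ≤ 4 * η / ωP := by
  have hμpos : ∀ σ, 0 < μ σ := by
    intro σ
    rw [hμ, isingGibbs]
    have : 0 < ∑ σ' : Fin n → Bool, Real.exp (isingEnergy J hfield σ') :=
      Finset.sum_pos (fun _ _ => Real.exp_pos _) ⟨σ, Finset.mem_univ _⟩
    positivity
  have hratio : ∀ σ, μ (flipAt u σ) =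
      μ σ * Real.exp (-2 * spin (σ u) * locField J hfield u σ) := by
    intro σ
    rw [hμ, hμ, isingGibbs, isingGibbs, energy_flip J hfield hJsymm, Real.exp_add]
    ring
  have hs : ∀ σ, ν σ * (Real.exp (-2 * spin (σ u) * locField J hfield u σ) *
      (-2 * spin (σ u) * g σ) /
        (1 + Real.exp (-2 * spin (σ u) * locField J hfield u σ))) =
      -2 * spin (σ u) * g σ * (ν σ * (μ (flipAt u σ) / (μ σ + μ (flipAt u σ)))) := by
    intro σ
    rw [hratio]
    have h1 := hμpos σ
    have h2 := Real.exp_pos (-2 * spin (σ u) * locField J hfield u σ)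
    generalize Real.exp (-2 * spin (σ u) * locField J hfield u σ) = e at h2 ⊢
    have : μ σ + μ σ * e ≠ 0 := by positivity
    field_simp
  have hc : ∀ σ, ωP * (μ (flipAt u σ) / (μ σ + μ (flipAt u σ))) ≤ P (flipAt u σ) σ := by
    intro σ
    have h := hflip σ u (!σ u)
    have e : boolCond μ σ u (!σ u) = μ (flipAt u σ) / (μ σ + μ (flipAt u σ)) := by
      have hself : Function.update σ u (σ u) = σ := Function.update_eq_self u σ
      unfold boolCond flipAt
      cases hb : σ u
      · rw [hb] at hself
        simp only [Bool.not_false]; rw [hself, add_comm]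
      · rw [hb] at hself
        simp only [Bool.not_true]; rw [hself]
    rw [e] at h
    have h1 := hμpos σ
    have h2 := hμpos (flipAt u σ)
    rw [ge_iff_le, le_div_iff₀ (by positivity)] at h
    exact h
  have hpair : ∀ σ, |ν σ * (μ (flipAt u σ) / (μ σ + μ (flipAt u σ))) -
      ν (flipAt u σ) * (μ σ / (μ (flipAt u σ) + μ σ))| ≤
      |P (flipAt u σ) σ * ν σ - P σ (flipAt u σ) * ν (flipAt u σ)| / ωP := by
    intro σ
    have h1 := hμpos σ
    have h2 := hμpos (flipAt u σ)
    have h3 := hc σ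
    have h4 := hrev σ (flipAt u σ)
    generalize μ σ = a at *
    generalize μ (flipAt u σ) = b at *
    generalize P (flipAt u σ) σ = p at *
    generalize P σ (flipAt u σ) = q at *
    generalize ν σ = x at *
    generalize ν (flipAt u σ) = y at *
    have hr : ∃ r, ωP ≤ r ∧ p = r * (b / (a + b)) ∧ q = r * (a / (b + a)) := by
      refine ⟨p / (b / (a + b)), ?_, ?_, ?_⟩
      · rw [le_div_iff₀ (by positivity)]; exact h3
      · field_simp
      · field_simp
        linear_combination (-(a + b)) * h4
    obtain ⟨r, hr, rfl, rfl⟩ := hr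
    rw [le_div_iff₀ hωP]
    have : r * (b / (a + b)) * x - r * (a / (b + a)) * y =
      (x * (b / (a + b)) - y * (a / (b + a))) * r := by ring
    rw [this, abs_mul, abs_of_pos (lt_of_lt_of_le hωP hr)]
    exact mul_le_mul_of_nonneg_left hr (abs_nonneg _)
  have hsym : ∑ σ, -2 * spin (σ u) * g σ * (ν σ * (μ (flipAt u σ) / (μ σ + μ (flipAt u σ)))) =
      ∑ σ, -(spin (σ u) * g σ) * (ν σ * (μ (flipAt u σ) / (μ σ + μ (flipAt u σ))) -
      ν (flipAt u σ) * (μ σ / (μ (flipAt u σ) + μ σ))) := by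
    set f : (Fin n → Bool) → ℝ := fun σ =>
      -(spin (σ u) * g σ) * (ν σ * (μ (flipAt u σ) / (μ σ + μ (flipAt u σ)))) with hf
    have e1 : ∀ σ, -2 * spin (σ u) * g σ * (ν σ * (μ (flipAt u σ) / (μ σ + μ (flipAt u σ)))) =
        f σ + f σ := by intro σ; simp only [hf]; ring
    have e2 : ∀ σ, -(spin (σ u) * g σ) * (ν σ * (μ (flipAt u σ) / (μ σ + μ (flipAt u σ))) -
      ν (flipAt u σ) * (μ σ / (μ (flipAt u σ) + μ σ))) = f σ + f (flipAt u σ) := by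
      intro σ; simp only [hf, flipAt_flipAt, hg, spin_flipAt, if_true]; ring
    simp only [e1, e2, Finset.sum_add_distrib, sum_flipAt]
  simp only [hs]
  rw [hsym]
  have hη : ∑ σ, |P (flipAt u σ) σ * ν σ - P σ (flipAt u σ) * ν (flipAt u σ)| ≤ 2 * η := by
    have : ∑ σ, |P (flipAt u σ) σ * ν σ - P σ (flipAt u σ) * ν (flipAt u σ)| ≤
        ∑ σ, ∑ σ', |P σ' σ * ν σ - P σ σ' * ν σ'| :=
      Finset.sum_le_sum fun σ _ =>
        Finset.single_le_sum (f := fun σ' => |P σ' σ * ν σ - P σ σ' * ν σ'|)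
          (fun _ _ => abs_nonneg _) (Finset.mem_univ (flipAt u σ))
    linarith
  have hη0 : 0 ≤ η := by
    have : 0 ≤ ∑ σ, |P (flipAt u σ) σ * ν σ - P σ (flipAt u σ) * ν (flipAt u σ)| :=
      Finset.sum_nonneg fun _ _ => abs_nonneg _
    linarith
  calc _ ≤ ∑ σ, |-(spin (σ u) * g σ) * (ν σ * (μ (flipAt u σ) / (μ σ + μ (flipAt u σ))) -
      ν (flipAt u σ) * (μ σ / (μ (flipAt u σ) + μ σ)))| := Finset.abs_sum_le_sum_abs _ _
    _ ≤ ∑ σ, |P (flipAt u σ) σ * ν σ - P σ (flipAt u σ) * ν (flipAt u σ)| / ωP := by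
      refine Finset.sum_le_sum fun σ _ => ?_
      rw [abs_mul, abs_neg, abs_mul, abs_spin, hg1, one_mul, one_mul]
      exact hpair σ
    _ ≤ 4 * η / ωP := by
      rw [← Finset.sum_div]
      gcongr
      linarith

/-- **Gradient of the population PL loss is small at the true parameters.** -/
theorem pl_gradient_small_at_true_parameters {n : ℕ}
    (J : Fin n → Fin n → ℝ) (hfield : Fin n → ℝ)
    (hJsymm : ∀ i j, J i j = J j i) (hJdiag : ∀ i, J i i = 0)
    (μ : (Fin n → Bool) → ℝ) (hμ : ∀ σ, μ σ = isingGibbs J hfield σ)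
    (P : (Fin n → Bool) → (Fin n → Bool) → ℝ)
    (hP0 : ∀ σ σ', 0 ≤ P σ' σ) (hP1 : ∀ σ, ∑ σ', P σ' σ = 1)
    (hrev : ∀ σ σ', P σ' σ * μ σ = P σ σ' * μ σ')
    (ωP : ℝ) (hωP : 0 < ωP)
    (hflip : ∀ (σ : Fin n → Bool) (u : Fin n) (q : Bool),
      P (Function.update σ u q) σ / boolCond μ σ u q ≥ ωP)
    (ν : (Fin n → Bool) → ℝ) (hνpos : ∀ σ, 0 < ν σ) (hν1 : ∑ σ, ν σ = 1)
    (η : ℝ)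
    (hmeta : (1 / 2) * ∑ σ, ∑ σ', |P σ' σ * ν σ - P σ σ' * ν σ'| ≤ η)
    (u : Fin n) :
    (∀ k : Fin n, k ≠ u →
      |deriv (fun t : ℝ =>
          popPL ν u (hfield u) (Function.update (fun v => J u v) k t)) (J u k)|
        ≤ 4 * η / ωP) ∧
    |deriv (fun t : ℝ => popPL ν u t (fun v => J u v)) (hfield u)| ≤ 4 * η / ωP := by
  have hmain := main_bound J hfield hJsymm μ hμ P hrev ωP hωP hflip ν η hmeta u
  constructor
  · intro k hk
    have e : (fun t : ℝ =>
          popPL ν u (hfield u) (Function.update (fun v => J u v) k t)) =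
        fun t : ℝ => ∑ σ, ν σ * Real.log (1 + Real.exp (-2 * spin (σ u) *
          (locField J hfield u σ + (t - J u k) * spin (σ k)))) := by
      funext t
      unfold popPL plIsing locField
      refine Finset.sum_congr rfl fun σ _ => ?_
      have : ∑ v ∈ Finset.univ.erase u, Function.update (fun v => J u v) k t v * spin (σ v) =
          ∑ v ∈ Finset.univ.erase u, J u v * spin (σ v) + (t - J u k) * spin (σ k) := by
        have hk' : k ∈ Finset.univ.erase u := by simp [hk]
        rw [← Finset.add_sum_erase _ _ hk', ← Finset.add_sum_erase _ _ hk']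
        have : ∑ v ∈ (Finset.univ.erase u).erase k,
            Function.update (fun v => J u v) k t v * spin (σ v) =
            ∑ v ∈ (Finset.univ.erase u).erase k, J u v * spin (σ v) := by
          refine Finset.sum_congr rfl fun v hv => ?_
          rw [Function.update_of_ne (Finset.ne_of_mem_erase hv)]
        rw [this, Function.update_self]
        ring
      rw [this, add_right_comm]
    rw [e, (hasDeriv_pop ν u (locField J hfield u) (fun σ => spin (σ k)) (J u k)).deriv]
    exact hmain _ (fun σ => by simp [spin_flipAt, hk]) (fun σ => abs_spin _)
  · have e : (fun t : ℝ => popPL ν u t (fun v => J u v)) =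
        fun t : ℝ => ∑ σ, ν σ * Real.log (1 + Real.exp (-2 * spin (σ u) *
          (locField J hfield u σ + (t - hfield u) * 1))) := by
      funext t
      unfold popPL plIsing locField
      refine Finset.sum_congr rfl fun σ _ => ?_
      congr 5
      ring
    rw [e, (hasDeriv_pop ν u (locField J hfield u) (fun _ => 1) (hfield u)).deriv]
    exact hmain _ (fun σ => rfl) (fun σ => abs_one)
end

section
/- Let f(x) = log(1 + exp(−2x)) and for reals x, ε define δf(x,ε) = f(x+ε) − f(x) − ε f′(x). If γ > 0 and max(|x|, |x+ε|) ≤ γ, then ε²/2 ≥ δf(x,ε) ≥ exp(−2γ) ε²/2. -/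
/-- The logistic-type function `f(x) = log(1 + e^{−2x})`. -/
noncomputable def logisticLoss (x : ℝ) : ℝ := Real.log (1 + Real.exp (-2 * x))

/-- A second-order lower bound from nonnegativity of the second derivative on an interval. -/
theorem taylor_nonneg_aux (g g1 g2 : ℝ → ℝ) (γ x y : ℝ)
    (h1 : ∀ t, HasDerivAt g (g1 t) t) (h2 : ∀ t, HasDerivAt g1 (g2 t) t)
    (h3 : ∀ t, |t| ≤ γ → 0 ≤ g2 t) (hx : |x| ≤ γ) (hy : |y| ≤ γ) :
    0 ≤ g y - g x - (y - x) * g1 x := by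
  have hmono : MonotoneOn g1 (Set.Icc (-γ) γ) := by
    apply monotoneOn_of_deriv_nonneg (convex_Icc _ _)
    · exact fun t _ => (h2 t).continuousAt.continuousWithinAt
    · exact fun t _ => (h2 t).differentiableAt.differentiableWithinAt
    · intro t ht
      rw [(h2 t).deriv]
      have ht2 : t ∈ Set.Icc (-γ) γ := interior_subset ht
      exact h3 t (abs_le.2 ht2)
  have hx' := abs_le.1 hx
  have hy' := abs_le.1 hy
  have hc : Continuous g := continuous_iff_continuousAt.2 fun t => (h1 t).continuousAt
  rcases lt_trichotomy x y with h | h | h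
  · obtain ⟨c, hc1, hc2⟩ := exists_hasDerivAt_eq_slope g g1 h hc.continuousOn (fun t _ => h1 t)
    rw [eq_div_iff (by linarith)] at hc2
    have := hmono ⟨hx'.1, hx'.2⟩ ⟨by linarith [hc1.1], by linarith [hc1.2]⟩ hc1.1.le
    nlinarith
  · subst h; simp
  · obtain ⟨c, hc1, hc2⟩ := exists_hasDerivAt_eq_slope g g1 h hc.continuousOn (fun t _ => h1 t)
    rw [eq_div_iff (by linarith)] at hc2
    have := hmono ⟨by linarith [hc1.1], by linarith [hc1.2]⟩ ⟨hx'.1, hx'.2⟩ hc1.2.le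
    nlinarith

theorem exp_hasDeriv_aux (t : ℝ) :
    HasDerivAt (fun t => 1 + Real.exp (-2 * t)) (-2 * Real.exp (-2 * t)) t := by
  have h := (((hasDerivAt_id t).const_mul (-2)).exp).const_add 1
  refine h.congr_deriv ?_
  simp [mul_comm]

theorem logisticLoss_hasDeriv (t : ℝ) :
    HasDerivAt logisticLoss (-2 + 2 / (1 + Real.exp (-2 * t))) t := by
  have hp := Real.exp_pos (-2 * t)
  refine ((exp_hasDeriv_aux t).log (by positivity)).congr_deriv ?_
  field_simp
  ring

theorem logisticLoss_hasDeriv2 (t : ℝ) :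
    HasDerivAt (fun t => -2 + 2 / (1 + Real.exp (-2 * t)))
      (4 * Real.exp (-2 * t) / (1 + Real.exp (-2 * t)) ^ 2) t := by
  have hp := Real.exp_pos (-2 * t)
  refine (((hasDerivAt_const t (2:ℝ)).div (exp_hasDeriv_aux t)
    (by positivity)).const_add (-2)).congr_deriv ?_
  ring

theorem curv_upper (t : ℝ) : 4 * Real.exp (-2 * t) / (1 + Real.exp (-2 * t)) ^ 2 ≤ 1 := by
  have hp := Real.exp_pos (-2 * t)
  rw [div_le_one (by positivity)]
  nlinarith [sq_nonneg (1 - Real.exp (-2 * t))]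

theorem curv_lower (t γ : ℝ) (h : |t| ≤ γ) :
    Real.exp (-2 * γ) ≤ 4 * Real.exp (-2 * t) / (1 + Real.exp (-2 * t)) ^ 2 := by
  have h' := abs_le.1 h
  have hp := Real.exp_pos (-2 * t)
  rw [le_div_iff₀ (by positivity)]
  have e1 : Real.exp (-t) ^ 2 = Real.exp (-2 * t) := by
    rw [← Real.exp_nat_mul]; congr 1; push_cast; ring
  have e2 : Real.exp (-γ) ^ 2 = Real.exp (-2 * γ) := by
    rw [← Real.exp_nat_mul]; congr 1; push_cast; ring
  have a1 : Real.exp (-γ) ≤ Real.exp (-t) := Real.exp_le_exp.2 (by linarith)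
  have a2 : Real.exp (-γ) * Real.exp (-t) ≤ 1 := by
    rw [← Real.exp_add]; exact Real.exp_le_one_iff.2 (by linarith)
  have p1 := Real.exp_pos (-t)
  have p2 := Real.exp_pos (-γ)
  rw [← e1, ← e2]
  have key : Real.exp (-γ) * (1 + Real.exp (-t) ^ 2) ≤ 2 * Real.exp (-t) := by nlinarith
  have := pow_le_pow_left₀ (by positivity) key 2
  nlinarith

/-- **Smoothness and strong convexity of `f`.**
If `max(|x|, |x+ε|) ≤ γ` with `γ > 0` then
`ε²/2 ≥ f(x+ε) − f(x) − ε f'(x) ≥ e^{−2γ} ε²/2`. -/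
theorem logisticLoss_curvature_bounds (γ x ε : ℝ) (hγ : 0 < γ)
    (hbound : max |x| |x + ε| ≤ γ) :
    logisticLoss (x + ε) - logisticLoss x - ε * deriv logisticLoss x ≤ ε ^ 2 / 2 ∧
    Real.exp (-2 * γ) * ε ^ 2 / 2 ≤
      logisticLoss (x + ε) - logisticLoss x - ε * deriv logisticLoss x := by
  have hx : |x| ≤ γ := (le_max_left _ _).trans hbound
  have hy : |x + ε| ≤ γ := (le_max_right _ _).trans hbound
  rw [(logisticLoss_hasDeriv x).deriv]
  have hq : ∀ c t : ℝ, HasDerivAt (fun t => c * t ^ 2 / 2) (c * t) t := by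
    intro c t
    refine (((hasDerivAt_pow 2 t).const_mul c).div_const 2).congr_deriv ?_
    push_cast
    ring
  have hl : ∀ c t : ℝ, HasDerivAt (fun t => c * t) c t := by
    intro c t
    simpa using (hasDerivAt_id t).const_mul c
  constructor
  · have := taylor_nonneg_aux _ _ _ γ x (x + ε)
      (fun t => (hq 1 t).sub (logisticLoss_hasDeriv t))
      (fun t => (hl 1 t).sub (logisticLoss_hasDeriv2 t))
      (fun t _ => sub_nonneg.2 (curv_upper t)) hx hy
    simp only [Pi.sub_apply] at this
    nlinarith
  · have := taylor_nonneg_aux _ _ _ γ x (x + ε)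
      (fun t => (logisticLoss_hasDeriv t).sub (hq (Real.exp (-2 * γ)) t))
      (fun t => (logisticLoss_hasDeriv2 t).sub (hl (Real.exp (-2 * γ)) t))
      (fun t ht => sub_nonneg.2 (curv_lower t γ ht)) hx hy
    simp only [Pi.sub_apply] at this
    nlinarith
end
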